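/- The automorphism group of the dihedral group of order 32 is isomorphic to the holomorph Hol(C₁₆). -/

import Mathlib

/-- The holomorph of a group `G`: the semidirect product `G ⋊ Aut G`, where
`Aut G` acts on `G` in the natural way. -/
abbrev Hol (G : Type*) [Group G] : Type _ := G ⋊[MonoidHom.id (MulAut G)] MulAut G

namespace DihedralGroup

open Multiplicative

variable {n : ℕ}

/-- The automorphism of `DihedralGroup n` induced by the element `(b, σ)` of the holomorph of
`ZMod n`: it sends `r i` to `r (σ i)` and `sr i` to `sr (b + σ i)`. -/
def mulAutOfHol (x : Hol (Multiplicative (ZMod n))) : MulAut (DihedralGroup n) where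
  toFun
    | r i => r (x.right (ofAdd i)).toAdd
    | sr i => sr (x.left * x.right (ofAdd i)).toAdd
  invFun
    | r i => r (x.right.symm (ofAdd i)).toAdd
    | sr i => sr (x.right.symm (x.left⁻¹ * ofAdd i)).toAdd
  left_inv := by rintro (i | i) <;> simp
  right_inv := by rintro (i | i) <;> simp
  map_mul' := by
    rintro (i | i) (j | j) <;> simp [ofAdd_add, ofAdd_sub] <;> ring

@[simp]
theorem mulAutOfHol_r (x : Hol (Multiplicative (ZMod n))) (i : ZMod n) :
    mulAutOfHol x (r i) = r (x.right (ofAdd i)).toAdd :=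
  rfl

@[simp]
theorem mulAutOfHol_sr (x : Hol (Multiplicative (ZMod n))) (i : ZMod n) :
    mulAutOfHol x (sr i) = sr (x.left * x.right (ofAdd i)).toAdd :=
  rfl

theorem mulAutOfHol_mul (x y : Hol (Multiplicative (ZMod n))) :
    mulAutOfHol (x * y) = mulAutOfHol x * mulAutOfHol y := by
  ext (i | i) <;> simp [add_assoc]

theorem mulAutOfHol_injective :
    Function.Injective (mulAutOfHol : Hol (Multiplicative (ZMod n)) → _) := by
  intro x y h
  have hright : x.right = y.right := MulEquiv.ext fun i => by
    simpa using DFunLike.congr_fun h (r i.toAdd)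
  have hleft : x.left = y.left := by
    simpa using DFunLike.congr_fun h (sr 0)
  exact SemidirectProduct.ext hleft hright

/-- For `n ∤ 2`, every automorphism of `DihedralGroup n` maps rotations to rotations. -/
theorem exists_mulAut_r_eq_r (hn : ¬ n ∣ 2) (f : MulAut (DihedralGroup n)) (i : ZMod n) :
    ∃ a, f (r i) = r a := by
  obtain ⟨k, rfl⟩ := ZMod.intCast_surjective i
  have hpow : f (r (k : ZMod n)) = f (r 1) ^ k := by rw [← map_zpow, r_one_zpow]
  rcases h : f (r 1) with a | a
  · exact ⟨a * k, by rw [hpow, h, r_zpow]⟩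
  · have hsq : f (r 1 * r 1) = f 1 := by rw [map_mul, h, sr_mul_self, map_one]
    have htwo : (1 + 1 : ZMod n) = 0 := by
      simpa [one_def, -r_zero] using f.injective hsq
    exact absurd ((ZMod.natCast_eq_zero_iff 2 n).1 (by rw [← htwo]; norm_num)) hn

/-- For `n ∤ 2`, every automorphism of `DihedralGroup n` maps reflections to reflections. -/
theorem exists_mulAut_sr_eq_sr (hn : ¬ n ∣ 2) (f : MulAut (DihedralGroup n)) (i : ZMod n) :
    ∃ a, f (sr i) = sr a := by
  rcases h : f (sr i) with a | a
  · obtain ⟨b, hb⟩ := exists_mulAut_r_eq_r hn f⁻¹ a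
    rw [← h, MulAut.inv_apply_self] at hb
    cases hb
  · exact ⟨a, rfl⟩

theorem mulAutOfHol_surjective (hn : ¬ n ∣ 2) :
    Function.Surjective (mulAutOfHol : Hol (Multiplicative (ZMod n)) → _) := by
  intro f
  choose σ hσ using exists_mulAut_r_eq_r hn f
  choose τ hτ using exists_mulAut_r_eq_r hn f⁻¹
  obtain ⟨b, hb⟩ := exists_mulAut_sr_eq_sr hn f 0
  let e : ZMod n ≃+ ZMod n :=
    { toFun := σ
      invFun := τ
      left_inv := fun i => r.inj (by rw [← hτ, ← hσ, MulAut.inv_apply_self])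
      right_inv := fun i => r.inj (by rw [← hσ, ← hτ, MulAut.apply_inv_self])
      map_add' := fun i j => r.inj (by rw [← hσ, ← r_mul_r, map_mul, hσ, hσ, r_mul_r]) }
  refine ⟨⟨ofAdd b, AddEquiv.toMultiplicative e⟩, ?_⟩
  ext (i | i)
  · exact (hσ i).symm
  · have hi : f (sr i) = sr (b + σ i) := by
      rw [← sr_mul_r, ← hb, ← hσ, ← map_mul, sr_mul_r, zero_add]
    exact hi.symm

/-- For `n ∤ 2`, the automorphism group of `DihedralGroup n` is the holomorph of the cyclic group
of order `n`. -/
noncomputable def holEquivMulAut (hn : ¬ n ∣ 2) :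
    Hol (Multiplicative (ZMod n)) ≃* MulAut (DihedralGroup n) :=
  MulEquiv.ofBijective (MonoidHom.mk' mulAutOfHol mulAutOfHol_mul)
    ⟨mulAutOfHol_injective, mulAutOfHol_surjective hn⟩

end DihedralGroup

/-- The automorphism group of the dihedral group of order 32 is isomorphic to the
holomorph `Hol (C₁₆)`. -/
theorem aut_D16_iso_hol_C16 :
    Nonempty (MulAut (DihedralGroup 16) ≃* Hol (Multiplicative (ZMod 16))) := by
  exact ⟨(DihedralGroup.holEquivMulAut (by norm_num)).symm⟩
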